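/- arXiv:1308.5355 — 3 statements merged into one kernel-verified Lean document; each statement's English description precedes it below -/
import Mathlib

section
/- Let K be a field, let m ≥ 1 be an integer such that m·1 ≠ 0 in K, let k be an integer, and let ζ_m be a primitive m-th root of unity lying in an extension field L of K. Then for every rational function φ ∈ K(z) there exists a unique rational function ψ ∈ K(z) such that, in L(w), the image of ψ under the homomorphism determined by z ↦ w^m equals (1/(m·w^k))·Σ_{t=0}^{m-1} ζ_m^{-kt}·φ(ζ_m^t w). Moreover ψ does not depend on the choice of the primitive m-th root of unity ζ_m in L. -/
universe u
open scoped BigOperators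

/-- The right-hand side `(1/(m·w^k))·Σ_{t=0}^{m-1} ζ^{-kt}·φ(ζ^t w)` of the defining
formula for the `(m,k)`-Landen transform, viewed as an element of `L(w)`.  Here
`φ(ζ^t w)` denotes the image of `φ` under the ring homomorphism `K(z) → L(w)`
restricting to `K ⊆ L` and sending `z ↦ ζ^t w`. -/
noncomputable def landenRHS (K L : Type u) [Field K] [Field L] [Algebra K L]
    (m : ℕ) (k : ℤ) (ζ : L) (φ : RatFunc K) : RatFunc L :=
  (1 / ((m : RatFunc L) * (RatFunc.X : RatFunc L) ^ k)) *
    ∑ t ∈ Finset.range m,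
      algebraMap L (RatFunc L) (ζ ^ (-(k * (t : ℤ)))) *
        RatFunc.eval ((algebraMap L (RatFunc L)).comp (algebraMap K L))
          (algebraMap L (RatFunc L) (ζ ^ t) * RatFunc.X) φ

/-- `ψ` is the `(m,k)`-Landen transform of `φ` (relative to the primitive `m`-th root of
unity `ζ ∈ L`): the image of `ψ` under the homomorphism `K(z) → L(w)` determined by
`z ↦ w^m` equals `(1/(m·w^k))·Σ_{t=0}^{m-1} ζ^{-kt}·φ(ζ^t w)`. -/
noncomputable def IsLanden (K L : Type u) [Field K] [Field L] [Algebra K L]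
    (m : ℕ) (k : ℤ) (ζ : L) (φ ψ : RatFunc K) : Prop :=
  RatFunc.eval ((algebraMap L (RatFunc L)).comp (algebraMap K L))
      ((RatFunc.X : RatFunc L) ^ m) ψ = landenRHS K L m k ζ φ

open Polynomial in
/-- The substitution `z ↦ a` for a nonconstant polynomial `a ∈ L[w]`, as a ring homomorphism
`K(z) → L(w)` given by `RatFunc.eval`. -/
theorem RatFunc.exists_ringHom_eq_eval (K : Type u) {L : Type u} [Field K] [Field L] [Algebra K L]
    (a : L[X]) (ha : a.natDegree ≠ 0) :
    ∃ E : RatFunc K →+* RatFunc L,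
      (∀ φ : RatFunc K, RatFunc.eval ((algebraMap L (RatFunc L)).comp (algebraMap K L))
        (algebraMap L[X] (RatFunc L) a) φ = E φ) ∧
      ∀ p : K[X], E (algebraMap K[X] (RatFunc K) p) =
        algebraMap L[X] (RatFunc L) ((p.map (algebraMap K L)).comp a) := by
  have key : ∀ p : K[X], eval₂RingHom ((algebraMap L (RatFunc L)).comp (algebraMap K L))
      (algebraMap L[X] (RatFunc L) a) p =
        algebraMap L[X] (RatFunc L) ((p.map (algebraMap K L)).comp a) := by
    intro p
    rw [coe_eval₂RingHom, comp, eval₂_map, hom_eval₂]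
    rfl
  have hinj : Function.Injective (eval₂RingHom ((algebraMap L (RatFunc L)).comp (algebraMap K L))
      (algebraMap L[X] (RatFunc L) a)) := by
    rw [injective_iff_map_eq_zero]
    intro p hp
    rw [key, FaithfulSMul.algebraMap_eq_zero_iff, comp_eq_zero_iff] at hp
    rcases hp with hp | ⟨-, hp⟩
    · exact (Polynomial.map_eq_zero _).1 hp
    · exact absurd (by rw [hp, natDegree_C]) ha
  refine ⟨RatFunc.liftRingHom _
    (nonZeroDivisors_le_comap_nonZeroDivisors_of_injective _ hinj), fun φ => ?_, fun p => ?_⟩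
  · rw [RatFunc.liftRingHom_apply]
    rfl
  · rw [RatFunc.liftRingHom_algebraMap, key]

open Polynomial in
/-- Every nonzero polynomial divides a nonzero polynomial in `X ^ m`. -/
theorem Polynomial.exists_dvd_expand {K : Type*} [Field K] (m : ℕ) {q : K[X]} (hq : q ≠ 0) :
    ∃ Q : K[X], Q ≠ 0 ∧ q ∣ expand K m Q := by
  have : Module.Finite K (AdjoinRoot q) := (AdjoinRoot.powerBasis hq).finite
  refine ⟨minpoly K (AdjoinRoot.root q ^ m),
    minpoly.ne_zero (Algebra.IsIntegral.isIntegral _), ?_⟩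
  rw [← AdjoinRoot.mk_eq_zero, ← AdjoinRoot.aeval_eq, expand_aeval, minpoly.aeval]

/-- The sum of the powers `ζ ^ (n t)`, `0 ≤ t < m`, for a primitive `m`-th root of unity `ζ`. -/
theorem IsPrimitiveRoot.sum_zpow_mul {L : Type*} [Field L] {m : ℕ} {ζ : L}
    (hζ : IsPrimitiveRoot ζ m) (n : ℤ) :
    ∑ t ∈ Finset.range m, ζ ^ (n * (t : ℤ)) = if (m : ℤ) ∣ n then (m : L) else 0 := by
  simp_rw [zpow_mul, zpow_natCast]
  split_ifs with h
  · simp [(hζ.zpow_eq_one_iff_dvd n).2 h]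
  · have h1 : ζ ^ n ≠ 1 := fun h' => h ((hζ.zpow_eq_one_iff_dvd n).1 h')
    rw [geom_sum_eq h1, ← zpow_natCast, zpow_comm, zpow_natCast, hζ.pow_eq_one]
    simp

section Landen

open Polynomial

variable {K L : Type u} [Field K] [Field L] [Algebra K L] {m : ℕ} {k : ℤ} {ζ : L}

theorem exists_ringHom_eval_X_pow (K L : Type u) [Field K] [Field L] [Algebra K L]
    (hm : m ≠ 0) : ∃ E : RatFunc K →+* RatFunc L,
      (∀ φ : RatFunc K, RatFunc.eval ((algebraMap L (RatFunc L)).comp (algebraMap K L))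
        ((RatFunc.X : RatFunc L) ^ m) φ = E φ) ∧ E RatFunc.X = RatFunc.X ^ m ∧
      ∀ p : K[X], E (algebraMap K[X] (RatFunc K) p) =
        algebraMap L[X] (RatFunc L) (expand L m (p.map (algebraMap K L))) := by
  obtain ⟨E, hE, hp⟩ := RatFunc.exists_ringHom_eq_eval K (X ^ m : L[X]) (by simpa using hm)
  refine ⟨E, fun φ => ?_, ?_, fun p => ?_⟩
  · rw [← hE, map_pow, RatFunc.algebraMap_X]
  · rw [← RatFunc.algebraMap_X, hp]
    simp
  · rw [hp, expand_eq_comp_X_pow]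

theorem exists_ringHom_eval_C_mul_X (K : Type u) [Field K] [Algebra K L] {c : L} (hc : c ≠ 0) :
    ∃ E : RatFunc K →+* RatFunc L,
      (∀ φ : RatFunc K, RatFunc.eval ((algebraMap L (RatFunc L)).comp (algebraMap K L))
        (algebraMap L (RatFunc L) c * RatFunc.X) φ = E φ) ∧
      ∀ p : K[X], E (algebraMap K[X] (RatFunc K) p) =
        algebraMap L[X] (RatFunc L) ((p.map (algebraMap K L)).comp (C c * X)) := by
  obtain ⟨E, hE, hp⟩ := RatFunc.exists_ringHom_eq_eval K (C c * X : L[X])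
    (by rw [natDegree_C_mul_X c hc]; exact one_ne_zero)
  refine ⟨E, fun φ => ?_, hp⟩
  rw [← hE, map_mul, RatFunc.algebraMap_X, RatFunc.algebraMap_C, RatFunc.algebraMap_eq_C]

theorem landenRHS_add (hζ : ζ ≠ 0) (φ₁ φ₂ : RatFunc K) :
    landenRHS K L m k ζ (φ₁ + φ₂) = landenRHS K L m k ζ φ₁ + landenRHS K L m k ζ φ₂ := by
  simp only [landenRHS]
  rw [← mul_add, ← Finset.sum_add_distrib]
  congr 1
  refine Finset.sum_congr rfl fun t _ => ?_
  obtain ⟨E, hE, -⟩ := exists_ringHom_eval_C_mul_X K (pow_ne_zero t hζ)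
  simp only [hE, map_add, mul_add]

theorem landenRHS_mul_expand (hm : m ≠ 0) (hζ : IsPrimitiveRoot ζ m) (φ : RatFunc K) (s : K[X]) :
    landenRHS K L m k ζ (φ * algebraMap K[X] (RatFunc K) (expand K m s)) =
      landenRHS K L m k ζ φ * RatFunc.eval ((algebraMap L (RatFunc L)).comp (algebraMap K L))
        ((RatFunc.X : RatFunc L) ^ m) (algebraMap K[X] (RatFunc K) s) := by
  simp only [landenRHS]
  rw [mul_assoc, Finset.sum_mul]
  congr 1
  refine Finset.sum_congr rfl fun t _ => ?_
  obtain ⟨E, hE, hp⟩ := exists_ringHom_eval_C_mul_X K (pow_ne_zero t (hζ.ne_zero hm))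
  obtain ⟨F, hF, -, hFp⟩ := exists_ringHom_eval_X_pow K L hm
  rw [hE, hE, hF, map_mul, hp, hFp, mul_assoc, map_expand, expand_eq_comp_X_pow, comp_assoc,
    X_pow_comp, mul_pow, ← C_pow, ← pow_mul, mul_comm t m, pow_mul,
    hζ.pow_eq_one, one_pow, C_1, one_mul]

theorem landenRHS_X_pow (hmL : (m : L) ≠ 0) (hζ : IsPrimitiveRoot ζ m) (i : ℕ) :
    landenRHS K L m k ζ (RatFunc.X ^ i) =
      if (m : ℤ) ∣ i - k then (RatFunc.X : RatFunc L) ^ ((i : ℤ) - k) else 0 := by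
  have hζ0 : ζ ≠ 0 := hζ.ne_zero (by rintro rfl; simp at hmL)
  have hX : (RatFunc.X : RatFunc L) ≠ 0 := RatFunc.X_ne_zero
  have hmR : (m : RatFunc L) ≠ 0 := by
    simpa using (map_ne_zero (algebraMap L (RatFunc L))).2 hmL
  have hterm : ∀ t : ℕ, algebraMap L (RatFunc L) (ζ ^ (-(k * (t : ℤ)))) *
        RatFunc.eval ((algebraMap L (RatFunc L)).comp (algebraMap K L))
          (algebraMap L (RatFunc L) (ζ ^ t) * RatFunc.X) (RatFunc.X ^ i : RatFunc K) =
      algebraMap L (RatFunc L) (ζ ^ (((i : ℤ) - k) * (t : ℤ))) * RatFunc.X ^ i := by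
    intro t
    obtain ⟨E, hE, -⟩ := exists_ringHom_eval_C_mul_X K (pow_ne_zero t hζ0)
    have hEX : E RatFunc.X = algebraMap L (RatFunc L) (ζ ^ t) * RatFunc.X := by
      rw [← hE, RatFunc.eval_X]
    rw [hE, map_pow, hEX, mul_pow, ← mul_assoc, ← map_pow, ← map_mul]
    congr 2
    rw [← pow_mul, ← zpow_natCast, ← zpow_add₀ hζ0]
    congr 1
    push_cast
    ring
  rw [landenRHS, Finset.sum_congr rfl fun t _ => hterm t, ← Finset.sum_mul, ← map_sum,
    hζ.sum_zpow_mul]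
  split_ifs with h
  · rw [map_natCast, zpow_sub₀ hX, zpow_natCast]
    field_simp
  · simp

/-- The transform exists, with the same value for all primitive `m`-th roots of unity. -/
theorem exists_forall_isLanden (K L : Type u) [Field K] [Field L] [Algebra K L] (m : ℕ)
    (hmK : (m : K) ≠ 0) (k : ℤ) (φ : RatFunc K) :
    ∃ ψ : RatFunc K, ∀ ζ : L, IsPrimitiveRoot ζ m → IsLanden K L m k ζ φ ψ := by
  have hm : m ≠ 0 := by rintro rfl; simp at hmK
  have hmL : (m : L) ≠ 0 := by simpa using (map_ne_zero (algebraMap K L)).2 hmK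
  obtain ⟨F, hF, hFX, -⟩ := exists_ringHom_eval_X_pow K L hm
  have hpoly : ∀ p : K[X], ∃ ψ : RatFunc K, ∀ ζ : L, IsPrimitiveRoot ζ m →
      IsLanden K L m k ζ (algebraMap K[X] (RatFunc K) p) ψ := by
    intro p
    induction p using Polynomial.induction_on' with
    | add p q hp hq =>
      obtain ⟨ψ₁, h₁⟩ := hp
      obtain ⟨ψ₂, h₂⟩ := hq
      refine ⟨ψ₁ + ψ₂, fun ζ hζ => ?_⟩
      have h₁ := h₁ ζ hζ
      have h₂ := h₂ ζ hζ
      rw [IsLanden, hF] at h₁ h₂ ⊢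
      rw [map_add, map_add, landenRHS_add (hζ.ne_zero hm), h₁, h₂]
    | monomial i a =>
      refine ⟨(if (m : ℤ) ∣ i - k then RatFunc.X ^ (((i : ℤ) - k) / m) else 0) *
        algebraMap K[X] (RatFunc K) (C a), fun ζ hζ => ?_⟩
      have hmon : algebraMap K[X] (RatFunc K) (monomial i a) =
          RatFunc.X ^ i * algebraMap K[X] (RatFunc K) (expand K m (C a)) := by
        rw [expand_C, ← C_mul_X_pow_eq_monomial, map_mul, map_pow, RatFunc.algebraMap_X, mul_comm]
      rw [IsLanden, hmon, landenRHS_mul_expand hm hζ, landenRHS_X_pow hmL hζ, hF, hF, map_mul]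
      congr 1
      split_ifs with h
      · rw [map_zpow₀, hFX, ← zpow_natCast, ← zpow_mul, Int.mul_ediv_cancel' h]
      · exact map_zero F
  obtain ⟨Q, hQ, r, hr⟩ := exists_dvd_expand m φ.denom_ne_zero
  obtain ⟨ψ, hψ⟩ := hpoly (φ.num * r)
  have hQ' : algebraMap K[X] (RatFunc K) Q ≠ 0 := RatFunc.algebraMap_ne_zero hQ
  refine ⟨ψ / algebraMap K[X] (RatFunc K) Q, fun ζ hζ => ?_⟩
  have hφ : φ * algebraMap K[X] (RatFunc K) (expand K m Q) =
      algebraMap K[X] (RatFunc K) (φ.num * r) := by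
    have hd := RatFunc.algebraMap_ne_zero φ.denom_ne_zero
    nth_rw 1 [← RatFunc.num_div_denom φ]
    rw [hr, map_mul, map_mul]
    field_simp
  have h := hψ ζ hζ
  rw [IsLanden, ← hφ, landenRHS_mul_expand hm hζ, hF, hF] at h
  rw [IsLanden, hF, map_div₀, h, mul_div_cancel_right₀ _ ((map_ne_zero F).2 hQ')]

end Landen

/-- For every rational function `φ ∈ K(z)` there is a unique rational
function `ψ ∈ K(z)` whose image under `z ↦ w^m` equals
`(1/(m·w^k))·Σ_{t=0}^{m-1} ζ^{-kt}·φ(ζ^t w)` in `L(w)`; moreover `ψ` is independent of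
the choice of the primitive `m`-th root of unity `ζ` in `L`. -/
theorem landen_exists_unique (K L : Type u) [Field K] [Field L] [Algebra K L]
    (m : ℕ) (hm : 1 ≤ m) (hmK : (m : K) ≠ 0) (k : ℤ)
    (ζ : L) (hζ : IsPrimitiveRoot ζ m) (φ : RatFunc K) :
    (∃! ψ : RatFunc K, IsLanden K L m k ζ φ ψ) ∧
      (∀ ζ' : L, IsPrimitiveRoot ζ' m →
        ∀ ψ : RatFunc K, IsLanden K L m k ζ φ ψ → IsLanden K L m k ζ' φ ψ) := by
  have hm0 : m ≠ 0 := Nat.one_le_iff_ne_zero.1 hm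
  obtain ⟨ψ₀, h₀⟩ := exists_forall_isLanden K L m hmK k φ
  have huniq : ∀ ψ, IsLanden K L m k ζ φ ψ → ψ = ψ₀ := by
    intro ψ hψ
    obtain ⟨F, hF, -⟩ := exists_ringHom_eval_X_pow K L hm0
    have h := hψ.trans (h₀ ζ hζ).symm
    rw [hF, hF] at h
    exact F.injective h
  refine ⟨⟨ψ₀, h₀ ζ hζ, huniq⟩, fun ζ' hζ' ψ hψ => ?_⟩
  rw [huniq ψ hψ]
  exact h₀ ζ' hζ'
end

section
/- Let K be a field, let m, n ≥ 1 be integers with m·n·1 ≠ 0 in K, let k, ℓ be integers, let L be an extension field of K containing a primitive mn-th root of unity ζ_{mn}, and set ζ_m = ζ_{mn}^n and ζ_n = ζ_{mn}^m. Then for every rational function φ ∈ K(z), 𝔉_{m,k}(𝔉_{n,ℓ}(φ)) = 𝔉_{mn, kn+ℓ}(φ). Consequently the r-th iterate of 𝔉_{m,k} equals 𝔉_{m^r, (m^{r-1}+m^{r-2}+⋯+m+1)k}. -/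
open scoped BigOperators

universe u

open Polynomial in
/-- Substitution of a nonconstant polynomial is injective on polynomials. -/
lemma eval₂_algebraMap_injective (K L : Type u) [Field K] [Field L] [Algebra K L]
    {q : L[X]} (hq : q.natDegree ≠ 0) :
    Function.Injective (eval₂RingHom ((algebraMap L (RatFunc L)).comp (algebraMap K L))
      (algebraMap L[X] (RatFunc L) q)) := by
  rw [injective_iff_map_eq_zero]
  intro p hp
  have key : eval₂RingHom ((algebraMap L (RatFunc L)).comp (algebraMap K L))
      (algebraMap L[X] (RatFunc L) q) p
        = algebraMap L[X] (RatFunc L) ((p.map (algebraMap K L)).comp q) := by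
    rw [coe_eval₂RingHom, comp, eval₂_map, hom_eval₂]
    congr 1
  rw [key, FaithfulSMul.algebraMap_eq_zero_iff, comp_eq_zero_iff] at hp
  rcases hp with hp | ⟨-, hp⟩
  · exact (Polynomial.map_eq_zero _).1 hp
  · exact absurd (by rw [hp, natDegree_C]) hq

open Polynomial in
/-- The homomorphism `K(z) → L(w)` sending `z` to a nonconstant polynomial `q`. -/
noncomputable def substHom (K L : Type u) [Field K] [Field L] [Algebra K L]
    (q : L[X]) (hq : q.natDegree ≠ 0) : RatFunc K →+* RatFunc L :=
  RatFunc.liftRingHom (eval₂RingHom ((algebraMap L (RatFunc L)).comp (algebraMap K L))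
      (algebraMap L[X] (RatFunc L) q))
    (nonZeroDivisors_le_comap_nonZeroDivisors_of_injective _
      (eval₂_algebraMap_injective K L hq))

section substHom

open Polynomial

variable {K L : Type u} [Field K] [Field L] [Algebra K L]

lemma eval_eq_substHom {q : L[X]} (hq : q.natDegree ≠ 0) (φ : RatFunc K) :
    RatFunc.eval (RatFunc.C.comp (algebraMap K L))
      (algebraMap L[X] (RatFunc L) q) φ = substHom K L q hq φ := by
  rw [substHom, RatFunc.liftRingHom_apply]
  rfl

lemma substHom_algebraMap {q : L[X]} (hq : q.natDegree ≠ 0) (p : K[X]) :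
    substHom K L q hq (algebraMap K[X] (RatFunc K) p)
      = eval₂ ((algebraMap L (RatFunc L)).comp (algebraMap K L))
          (algebraMap L[X] (RatFunc L) q) p := by
  simp [substHom]

@[simp]
lemma substHom_X {q : L[X]} (hq : q.natDegree ≠ 0) :
    substHom K L q hq RatFunc.X = algebraMap L[X] (RatFunc L) q := by
  rw [← RatFunc.algebraMap_X, substHom_algebraMap, eval₂_X]

@[simp]
lemma substHom_C {q : L[X]} (hq : q.natDegree ≠ 0) (c : K) :
    substHom K L q hq (RatFunc.C c) = RatFunc.C (algebraMap K L c) := by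
  rw [← RatFunc.algebraMap_C, substHom_algebraMap, eval₂_C]
  rfl

lemma ratFunc_ringHom_ext {S : Type*} [Field S] {f g : RatFunc K →+* S}
    (hC : ∀ c : K, f (RatFunc.C c) = g (RatFunc.C c))
    (hX : f RatFunc.X = g RatFunc.X) : f = g := by
  refine IsLocalization.ringHom_ext (nonZeroDivisors K[X]) (Polynomial.ringHom_ext ?_ ?_)
  · intro c
    simpa using hC c
  · simpa using hX

lemma substHom_substHom {M : Type u} [Field M] [Algebra K M] [Algebra L M]
    [IsScalarTower K L M] {p : L[X]} {q r : M[X]} (hp : p.natDegree ≠ 0) (hq : q.natDegree ≠ 0)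
    (hr : r.natDegree ≠ 0)
    (h : substHom L M q hq (algebraMap L[X] (RatFunc L) p) = algebraMap M[X] (RatFunc M) r)
    (φ : RatFunc K) :
    substHom L M q hq (substHom K L p hp φ) = substHom K M r hr φ := by
  have : (substHom L M q hq).comp (substHom K L p hp) = substHom K M r hr := by
    apply ratFunc_ringHom_ext
    · intro c
      simp [← IsScalarTower.algebraMap_apply K L M]
    · simpa using h
  exact RingHom.congr_fun this φ

lemma natDegree_X_pow_ne_zero {m : ℕ} (hm : m ≠ 0) : (X ^ m : L[X]).natDegree ≠ 0 := by
  simpa using hm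

lemma natDegree_C_mul_X_ne_zero {c : L} (hc : c ≠ 0) : (C c * X : L[X]).natDegree ≠ 0 := by
  simp [natDegree_C_mul_X c hc]

/-- The substitution `z ↦ w ^ m`. -/
noncomputable def powHom (K L : Type u) [Field K] [Field L] [Algebra K L] {m : ℕ} (hm : m ≠ 0) :
    RatFunc K →+* RatFunc L :=
  substHom K L (X ^ m) (natDegree_X_pow_ne_zero hm)

/-- The substitution `z ↦ c w`. -/
noncomputable def scaleHom (K L : Type u) [Field K] [Field L] [Algebra K L] {c : L} (hc : c ≠ 0) :
    RatFunc K →+* RatFunc L :=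
  substHom K L (C c * X) (natDegree_C_mul_X_ne_zero hc)

@[simp]
lemma powHom_X {m : ℕ} (hm : m ≠ 0) : powHom K L hm RatFunc.X = RatFunc.X ^ m := by
  simp [powHom]

@[simp]
lemma powHom_C {m : ℕ} (hm : m ≠ 0) (c : K) :
    powHom K L hm (RatFunc.C c) = RatFunc.C (algebraMap K L c) :=
  substHom_C _ c

@[simp]
lemma scaleHom_C {c : L} (hc : c ≠ 0) (a : K) :
    scaleHom K L hc (RatFunc.C a) = RatFunc.C (algebraMap K L a) :=
  substHom_C _ a

@[simp]
lemma scaleHom_X {c : L} (hc : c ≠ 0) :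
    scaleHom K L hc RatFunc.X = RatFunc.C c * RatFunc.X := by
  simp [scaleHom]

lemma powHom_powHom {m n : ℕ} (hm : m ≠ 0) (hn : n ≠ 0) (φ : RatFunc K) :
    powHom L L hn (powHom K L hm φ) = powHom K L (mul_ne_zero hm hn) φ := by
  refine substHom_substHom _ _ _ ?_ φ
  simp [← pow_mul, mul_comm]

lemma powHom_scaleHom {n : ℕ} (hn : n ≠ 0) {c : L} (hc : c ≠ 0) (φ : RatFunc K) :
    powHom L L hn (scaleHom K L (pow_ne_zero n hc) φ)
      = scaleHom L L hc (powHom K L hn φ) := by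
  have : (powHom L L hn).comp (scaleHom K L (pow_ne_zero n hc))
      = (scaleHom L L hc).comp (powHom K L hn) := by
    apply ratFunc_ringHom_ext
    · intro a
      simp
    · simp [mul_pow]
  exact RingHom.congr_fun this φ

lemma scaleHom_scaleHom {c d : L} (hc : c ≠ 0) (hd : d ≠ 0) (φ : RatFunc K) :
    scaleHom L L hc (scaleHom K L hd φ) = scaleHom K L (mul_ne_zero hd hc) φ := by
  have : (scaleHom L L hc).comp (scaleHom K L hd) = scaleHom K L (mul_ne_zero hd hc) := by
    apply ratFunc_ringHom_ext
    · intro a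
      simp
    · simp [mul_assoc]
  exact RingHom.congr_fun this φ

lemma scaleHom_powHom {m : ℕ} (hm : m ≠ 0) {c : L} (hc : c ≠ 0) (hcm : c ^ m = 1)
    (φ : RatFunc K) : scaleHom K L hc (powHom K K hm φ) = powHom K L hm φ := by
  refine substHom_substHom _ _ _ ?_ φ
  rw [map_pow, RatFunc.algebraMap_X, map_pow, substHom_X, ← map_pow, mul_pow, ← C_pow, hcm]
  simp

lemma isLanden_iff {m : ℕ} (hm : m ≠ 0) {k : ℤ} {ζ : L} (hζ : ζ ≠ 0) {φ ψ : RatFunc K} :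
    IsLanden K L m k ζ φ ψ ↔
      powHom K L hm ψ = (1 / ((m : RatFunc L) * RatFunc.X ^ k)) *
        ∑ t ∈ Finset.range m, RatFunc.C (ζ ^ (-(k * (t : ℤ)))) *
          scaleHom K L (pow_ne_zero t hζ) φ := by
  have h₁ : (RatFunc.X : RatFunc L) ^ m = algebraMap L[X] (RatFunc L) (X ^ m) := by simp
  have h₂ (t : ℕ) : RatFunc.C (ζ ^ t) * RatFunc.X
      = algebraMap L[X] (RatFunc L) (C (ζ ^ t) * X) := by
    rw [map_mul, RatFunc.algebraMap_X, RatFunc.algebraMap_C]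
  rw [IsLanden, landenRHS, RatFunc.algebraMap_eq_C, h₁,
    eval_eq_substHom (natDegree_X_pow_ne_zero hm)]
  simp_rw [h₂, eval_eq_substHom (natDegree_C_mul_X_ne_zero (pow_ne_zero _ hζ))]
  rfl

end substHom

section Landen

variable {K L : Type u} [Field K] [Field L] [Algebra K L]

lemma IsLanden.unique {m : ℕ} (hm : m ≠ 0) {k : ℤ} {ζ : L} (hζ : ζ ≠ 0) {φ ψ ψ' : RatFunc K}
    (h : IsLanden K L m k ζ φ ψ) (h' : IsLanden K L m k ζ φ ψ') : ψ = ψ' := by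
  rw [isLanden_iff hm hζ] at h h'
  exact (powHom K L hm).injective (h.trans h'.symm)

lemma IsLanden.zero {m : ℕ} (hm : m ≠ 0) {k : ℤ} {ζ : L} (hζ : ζ ≠ 0) :
    IsLanden K L m k ζ 0 0 := by
  simp [isLanden_iff hm hζ]

lemma IsLanden.add {m : ℕ} (hm : m ≠ 0) {k : ℤ} {ζ : L} (hζ : ζ ≠ 0) {φ ψ φ' ψ' : RatFunc K}
    (h : IsLanden K L m k ζ φ ψ) (h' : IsLanden K L m k ζ φ' ψ') :
    IsLanden K L m k ζ (φ + φ') (ψ + ψ') := by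
  rw [isLanden_iff hm hζ] at h h' ⊢
  simp only [map_add, mul_add, Finset.sum_add_distrib, h, h']

lemma sum_range_mul_eq {M : Type*} [AddCommMonoid M] (f : ℕ → M) (m n : ℕ) :
    ∑ u ∈ Finset.range (m * n), f u
      = ∑ s ∈ Finset.range m, ∑ t ∈ Finset.range n, f (s + m * t) := by
  rw [Finset.sum_comm]
  induction n with
  | zero => simp
  | succ n ih =>
    rw [mul_add_one, Finset.sum_range_add, ih, Finset.sum_range_succ]
    simp only [add_comm]

/-- The composition law for Landen transforms relative to compatible roots of unity. -/
lemma IsLanden.comp {m n : ℕ} (hm : m ≠ 0) (hn : n ≠ 0) {k l : ℤ} {ζ : L}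
    (hζ : ζ ^ (m * n) = 1) {φ χ ψ : RatFunc K} (hχ : IsLanden K L n l (ζ ^ m) φ χ)
    (hψ : IsLanden K L m k (ζ ^ n) χ ψ) : IsLanden K L (m * n) (k * n + l) ζ φ ψ := by
  have hmn := mul_ne_zero hm hn
  have hζ0 : ζ ≠ 0 := by
    rintro rfl
    simp [hmn] at hζ
  have hX : (RatFunc.X : RatFunc L) ≠ 0 := RatFunc.X_ne_zero
  rw [isLanden_iff hn (pow_ne_zero m hζ0)] at hχ
  rw [isLanden_iff hm (pow_ne_zero n hζ0)] at hψ
  rw [isLanden_iff hmn hζ0, ← powHom_powHom hm hn, hψ, sum_range_mul_eq]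
  simp only [map_mul, map_sum, map_div₀, map_one, map_natCast, map_zpow₀, powHom_X, powHom_C,
    Algebra.algebraMap_self_apply]
  have hterm (s : ℕ) : powHom L L hn (scaleHom K L (pow_ne_zero s (pow_ne_zero n hζ0)) χ)
      = 1 / ((n : RatFunc L) * (RatFunc.C (ζ ^ s) * RatFunc.X) ^ l) *
        ∑ t ∈ Finset.range n, RatFunc.C ((ζ ^ m) ^ (-(l * (t : ℤ)))) *
          scaleHom K L (pow_ne_zero (s + m * t) hζ0) φ := by
    have h := powHom_scaleHom (K := K) hn (pow_ne_zero s hζ0) χ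
    simp only [← pow_mul, mul_comm s n] at h ⊢
    rw [h, hχ]
    simp only [map_mul, map_sum, map_div₀, map_one, map_natCast, map_zpow₀, scaleHom_X,
      scaleHom_scaleHom]
    congr 1
    refine Finset.sum_congr rfl fun t _ => ?_
    congr 1
    · simp [scaleHom]
    · simp only [← pow_mul, ← pow_add, add_comm]
  simp only [hterm, Finset.mul_sum, Nat.cast_mul]
  refine Finset.sum_congr rfl fun s _ => Finset.sum_congr rfl fun t _ => ?_
  have hexp : ζ ^ (-((k * n + l) * ((s + m * t : ℕ) : ℤ)))
      = (ζ ^ n) ^ (-(k * (s : ℤ))) * (ζ ^ s) ^ (-l) * (ζ ^ m) ^ (-(l * (t : ℤ))) := by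
    have h1 : ζ ^ (((m * n : ℕ) : ℤ) * (-(k * t))) = 1 := by
      rw [zpow_mul, zpow_natCast, hζ, one_zpow]
    simp only [← zpow_natCast, ← zpow_mul, ← zpow_add₀ hζ0]
    rw [← mul_one (ζ ^ (_ + _)), ← h1, ← zpow_add₀ hζ0]
    congr 1
    push_cast
    ring
  rw [← map_zpow₀, ← map_zpow₀, hexp, zpow_add₀ hX,
    mul_comm k (n : ℤ), zpow_mul, zpow_natCast, mul_zpow]
  simp only [map_mul, zpow_neg, map_inv₀, map_zpow₀, one_div, mul_inv]
  ring

lemma IsPrimitiveRoot.sum_zpow_eq_zero {m : ℕ} {ζ : L} (hζ : IsPrimitiveRoot ζ m) {j : ℤ}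
    (hj : ¬ (m : ℤ) ∣ j) : ∑ t ∈ Finset.range m, (ζ ^ j) ^ t = 0 := by
  have h1 : ζ ^ j - 1 ≠ 0 := sub_ne_zero.2 (mt (hζ.zpow_eq_one_iff_dvd j).1 hj)
  refine (mul_eq_zero.1 ((geom_sum_mul (ζ ^ j) m).trans ?_)).resolve_right h1
  rw [← zpow_natCast, zpow_comm, zpow_natCast, hζ.pow_eq_one, one_zpow, sub_self]

/-- The defining sum of the Landen transform of `z ^ i * θ(z ^ m)`. -/
lemma isLanden_X_pow_mul_powHom_iff {m : ℕ} (hm : m ≠ 0) {k : ℤ} {ζ : L}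
    (hζ : IsPrimitiveRoot ζ m) (i : ℕ) {θ ψ : RatFunc K} :
    IsLanden K L m k ζ (RatFunc.X ^ i * powHom K K hm θ) ψ ↔
      powHom K L hm ψ = (1 / ((m : RatFunc L) * RatFunc.X ^ k)) *
        (RatFunc.C (∑ t ∈ Finset.range m, (ζ ^ ((i : ℤ) - k)) ^ t) *
          (RatFunc.X ^ i * powHom K L hm θ)) := by
  have hζ0 : ζ ≠ 0 := hζ.ne_zero hm
  rw [isLanden_iff hm hζ0, map_sum, Finset.sum_mul]
  refine Eq.congr_right (congrArg _ (Finset.sum_congr rfl fun t _ => ?_))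
  have hexp : (ζ ^ ((i : ℤ) - k)) ^ t = ζ ^ (-(k * (t : ℤ))) * (ζ ^ t) ^ i := by
    simp only [← zpow_natCast, ← zpow_mul, ← zpow_add₀ hζ0]
    congr 1
    ring
  rw [map_mul, scaleHom_powHom hm (pow_ne_zero t hζ0)
    (by rw [← pow_mul, mul_comm, pow_mul, hζ.pow_eq_one, one_pow]), map_pow, scaleHom_X, hexp,
    mul_pow, map_mul, map_pow RatFunc.C (ζ ^ t) i]
  ring

end Landen

section Independence

variable {K : Type u} [Field K]

/-- The Landen transform of `z ^ i * θ(z ^ m)` exists over `K` and does not depend on the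
choice of the primitive root of unity. -/
lemma exists_isLanden_X_pow_mul_powHom {m : ℕ} (hmK : (m : K) ≠ 0) (hm : m ≠ 0) (k : ℤ) (i : ℕ)
    (θ : RatFunc K) :
    ∃ ψ : RatFunc K, ∀ (L : Type u) [Field L] [Algebra K L] (ζ : L), IsPrimitiveRoot ζ m →
      IsLanden K L m k ζ (RatFunc.X ^ i * powHom K K hm θ) ψ := by
  by_cases hj : (m : ℤ) ∣ (i : ℤ) - k
  · obtain ⟨d, hd⟩ := hj
    refine ⟨RatFunc.X ^ d * θ, fun L _ _ ζ hζ => ?_⟩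
    have hmL : (m : RatFunc L) ≠ 0 := by
      have h := (map_ne_zero ((RatFunc.C (K := L)).comp (algebraMap K L))).2 hmK
      rwa [map_natCast] at h
    have hX : (RatFunc.X : RatFunc L) ≠ 0 := RatFunc.X_ne_zero
    rw [isLanden_X_pow_mul_powHom_iff hm hζ, hd, zpow_mul, zpow_natCast, hζ.pow_eq_one]
    have hi : (RatFunc.X : RatFunc L) ^ i = RatFunc.X ^ k * (RatFunc.X ^ m) ^ d := by
      rw [← zpow_natCast, ← zpow_natCast, ← zpow_mul, ← hd, ← zpow_add₀ hX]
      congr 1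
      ring
    simp only [map_mul, map_zpow₀, powHom_X, hi, one_zpow, one_pow, Finset.sum_const,
      Finset.card_range, nsmul_eq_mul, mul_one, map_natCast]
    have hXk := zpow_ne_zero k hX
    field_simp
  · refine ⟨0, fun L _ _ ζ hζ => ?_⟩
    rw [isLanden_X_pow_mul_powHom_iff hm hζ, hζ.sum_zpow_eq_zero hj]
    simp

open Polynomial in
/-- Every rational function in `z` is a polynomial in `z` with coefficients in `K(z ^ m)`. -/
lemma exists_eq_sum_powHom {m : ℕ} (hm : m ≠ 0) (φ : RatFunc K) :
    ∃ (s : Finset ℕ) (θ : ℕ → RatFunc K),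
      φ = ∑ i ∈ s, RatFunc.X ^ i * powHom K K hm (θ i) := by
  let F : Subfield (RatFunc K) := (powHom K K hm).fieldRange
  have hXm : (RatFunc.X : RatFunc K) ^ m ∈ F := ⟨RatFunc.X, powHom_X hm⟩
  have hint : IsIntegral F (RatFunc.X : RatFunc K) := by
    refine IsIntegral.of_pow (Nat.pos_of_ne_zero hm) ?_
    exact isIntegral_algebraMap (x := (⟨_, hXm⟩ : F))
  have hpoly (p : K[X]) : algebraMap K[X] (RatFunc K) p
      ∈ IntermediateField.adjoin F {(RatFunc.X : RatFunc K)} := by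
    induction p using Polynomial.induction_on' with
    | add p q hp hq =>
      rw [map_add]
      exact add_mem hp hq
    | monomial n a =>
      rw [← C_mul_X_pow_eq_monomial, map_mul, map_pow, RatFunc.algebraMap_C,
        RatFunc.algebraMap_X]
      refine mul_mem ?_ (pow_mem (IntermediateField.mem_adjoin_simple_self F _) n)
      exact IntermediateField.algebraMap_mem _ (⟨RatFunc.C a, RatFunc.C a, by simp⟩ : F)
  have hφ : φ ∈ IntermediateField.adjoin F {(RatFunc.X : RatFunc K)} := by
    rw [← RatFunc.num_div_denom φ]
    exact div_mem (hpoly _) (hpoly _)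
  rw [← IntermediateField.mem_toSubalgebra,
    IntermediateField.adjoin_simple_toSubalgebra_of_isAlgebraic hint.isAlgebraic,
    Algebra.adjoin_singleton_eq_range_aeval] at hφ
  obtain ⟨p, rfl⟩ := hφ
  choose θ hθ using fun i => (p.coeff i).2
  refine ⟨p.support, θ, ?_⟩
  simp only [AlgHom.toRingHom_eq_coe, RingHom.coe_coe, aeval_def, eval₂_eq_sum, sum_def]
  exact Finset.sum_congr rfl fun i _ => by rw [hθ, mul_comm]; rfl

/-- Landen transforms exist over `K`, independently of the primitive root of unity. -/
lemma exists_isLanden {m : ℕ} (hmK : (m : K) ≠ 0) (hm : m ≠ 0) (k : ℤ) (φ : RatFunc K) :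
    ∃ ψ : RatFunc K, ∀ (L : Type u) [Field L] [Algebra K L] (ζ : L), IsPrimitiveRoot ζ m →
      IsLanden K L m k ζ φ ψ := by
  obtain ⟨s, θ, rfl⟩ := exists_eq_sum_powHom hm φ
  induction s using Finset.induction_on with
  | empty => exact ⟨0, fun L _ _ ζ hζ => by simpa using IsLanden.zero hm (hζ.ne_zero hm)⟩
  | insert i s hi ih =>
    obtain ⟨ψ, hψ⟩ := ih
    obtain ⟨ψ', hψ'⟩ := exists_isLanden_X_pow_mul_powHom hmK hm k i (θ i)
    refine ⟨ψ' + ψ, fun L _ _ ζ hζ => ?_⟩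
    rw [Finset.sum_insert hi]
    exact (hψ' L ζ hζ).add hm (hζ.ne_zero hm) (hψ L ζ hζ)

/-- The Landen transform does not depend on the choice of the primitive root of unity. -/
lemma IsLanden.of_isPrimitiveRoot {L L' : Type u} [Field L] [Algebra K L] [Field L'] [Algebra K L']
    {m : ℕ} (hmK : (m : K) ≠ 0) (hm : m ≠ 0) {k : ℤ} {ζ : L} {ζ' : L'}
    (hζ : IsPrimitiveRoot ζ m) (hζ' : IsPrimitiveRoot ζ' m) {φ ψ : RatFunc K}
    (h : IsLanden K L m k ζ φ ψ) : IsLanden K L' m k ζ' φ ψ := by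
  obtain ⟨ψ', hψ'⟩ := exists_isLanden hmK hm k φ
  rw [h.unique hm (hζ.ne_zero hm) (hψ' L ζ hζ)]
  exact hψ' L' ζ' hζ'

/-- The iterates of a Landen transform. -/
lemma IsLanden.iterate {L : Type u} [Field L] [Algebra K L] {m : ℕ} (hmK : (m : K) ≠ 0)
    (hm : m ≠ 0) {k : ℤ} {ζ : L} (hζ : IsPrimitiveRoot ζ m) {F : RatFunc K → RatFunc K}
    (hF : ∀ φ, IsLanden K L m k ζ φ (F φ)) {L' : Type u} [Field L'] [Algebra K L'] (r : ℕ)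
    {ζ' : L'} (hζ' : IsPrimitiveRoot ζ' (m ^ r)) (φ : RatFunc K) :
    IsLanden K L' (m ^ r) ((∑ i ∈ Finset.range r, (m : ℤ) ^ i) * k) ζ' φ (F^[r] φ) := by
  induction r generalizing ζ' with
  | zero =>
    obtain rfl : ζ' = 1 := by simpa using hζ'
    rw [isLanden_iff (pow_ne_zero 0 hm) one_ne_zero]
    have h : powHom K L' (pow_ne_zero 0 hm) = scaleHom K L' (pow_ne_zero 0 one_ne_zero) :=
      ratFunc_ringHom_ext (by simp) (by simp)
    simpa using RingHom.congr_fun h φ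
  | succ r ih =>
    have hpos : 0 < m ^ (r + 1) := pow_pos (Nat.pos_of_ne_zero hm) _
    have h := IsLanden.comp hm (pow_ne_zero r hm) (by rw [← pow_succ', hζ'.pow_eq_one])
      (ih (hζ'.pow hpos (pow_succ' m r)))
      ((hF (F^[r] φ)).of_isPrimitiveRoot hmK hm hζ (hζ'.pow hpos (pow_succ m r)))
    rw [Function.iterate_succ_apply', pow_succ', Finset.sum_range_succ]
    convert h using 1
    push_cast
    ring

end Independence

/-- Composition law for Landen transforms:
`𝔉_{m,k} ∘ 𝔉_{n,ℓ} = 𝔉_{mn, kn+ℓ}`, where `ζ_m = ζ_{mn}^n` and `ζ_n = ζ_{mn}^m`;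
consequently the `r`-th iterate of `𝔉_{m,k}` is `𝔉_{m^r,(m^{r-1}+⋯+m+1)k}`. -/
theorem landen_comp (K L : Type u) [Field K] [Field L] [Algebra K L]
    (m n : ℕ) (hm : 1 ≤ m) (hn : 1 ≤ n) (hmn : ((m * n : ℕ) : K) ≠ 0)
    (k l : ℤ) (ζ : L) (hζ : IsPrimitiveRoot ζ (m * n))
    (Fmk Fnl Fmnl : RatFunc K → RatFunc K)
    (hFmk : ∀ φ : RatFunc K, IsLanden K L m k (ζ ^ n) φ (Fmk φ))
    (hFnl : ∀ φ : RatFunc K, IsLanden K L n l (ζ ^ m) φ (Fnl φ))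
    (hFmnl : ∀ φ : RatFunc K, IsLanden K L (m * n) (k * n + l) ζ φ (Fmnl φ)) :
    (∀ φ : RatFunc K, Fmk (Fnl φ) = Fmnl φ) ∧
    (∀ (r : ℕ) (L' : Type u) [Field L'] [Algebra K L'] (ζ' : L'),
      IsPrimitiveRoot ζ' (m ^ r) →
      ∀ Fr : RatFunc K → RatFunc K,
        (∀ φ : RatFunc K,
          IsLanden K L' (m ^ r) ((∑ i ∈ Finset.range r, (m : ℤ) ^ i) * k) ζ' φ (Fr φ)) →
        ∀ φ : RatFunc K, Fmk^[r] φ = Fr φ) := by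
  have hm0 : m ≠ 0 := Nat.one_le_iff_ne_zero.1 hm
  have hn0 : n ≠ 0 := Nat.one_le_iff_ne_zero.1 hn
  have hmn0 : m * n ≠ 0 := mul_ne_zero hm0 hn0
  have hmK : (m : K) ≠ 0 := fun h => hmn (by rw [Nat.cast_mul, h, zero_mul])
  refine ⟨fun φ => ?_, fun r L' _ _ ζ' hζ' Fr hFr φ => ?_⟩
  · exact (IsLanden.comp hm0 hn0 hζ.pow_eq_one (hFnl φ) (hFmk _)).unique hmn0
      (hζ.ne_zero hmn0) (hFmnl φ)
  · have hζm : IsPrimitiveRoot (ζ ^ n) m := hζ.pow (Nat.pos_of_ne_zero hmn0) (mul_comm m n)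
    exact (IsLanden.iterate hmK hm0 hζm hFmk r hζ' φ).unique (pow_ne_zero r hm0)
      (hζ'.ne_zero (pow_ne_zero r hm0)) (hFr φ)
end

section
/- Let K be a field, let m, n ≥ 1 be integers with m·n·1 ≠ 0 in K, and let k, ℓ be integers. If 𝔉_{m,k}(φ) = 𝔉_{n,ℓ}(φ) for every rational function φ ∈ K(z), then m = n and k = ℓ. (Hence the assignment sending the integer matrix (m 0; k 1) with m ≥ 1 to the operator 𝔉_{m,k} is injective, and together with the composition law 𝔉_{m,k}∘𝔉_{n,ℓ} = 𝔉_{mn,kn+ℓ} it is a monoid isomorphism onto the monoid of Landen transform operators.) -/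
open scoped BigOperators

universe u

/-- A polynomial over a subfield does not vanish at a nonconstant monomial of `L(w)`. -/
theorem eval₂_monomial_ne_zero (K : Type u) {L : Type u} [Field K] [Field L] [Algebra K L]
    {c : L} (hc : c ≠ 0) {d : ℕ} (hd : d ≠ 0) {p : Polynomial K} (hp : p ≠ 0) :
    p.eval₂ ((algebraMap L (RatFunc L)).comp (algebraMap K L))
      (algebraMap L (RatFunc L) c * RatFunc.X ^ d) ≠ 0 := by
  have key : p.eval₂ ((algebraMap L (RatFunc L)).comp (algebraMap K L))
      (algebraMap L (RatFunc L) c * RatFunc.X ^ d) =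
      algebraMap (Polynomial L) (RatFunc L)
        ((p.map (algebraMap K L)).comp (Polynomial.C c * Polynomial.X ^ d)) := by
    rw [Polynomial.comp, Polynomial.hom_eval₂, Polynomial.eval₂_map]
    congr 1
    simp [RatFunc.algebraMap_X, RatFunc.algebraMap_eq_C, RatFunc.algebraMap_C]
  rw [key]
  refine RatFunc.algebraMap_ne_zero fun h0 => ?_
  rcases Polynomial.comp_eq_zero_iff.1 h0 with h | ⟨-, h⟩
  · exact hp ((Polynomial.map_eq_zero _).1 h)
  · have := congrArg Polynomial.natDegree h
    rw [Polynomial.natDegree_C_mul_X_pow _ _ hc, Polynomial.natDegree_C] at this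
    exact hd this

/-- Substitution of a nonconstant monomial `c w ^ d` as a ring homomorphism `K(z) → L(w)`. -/
noncomputable def evalMonomialHom (K : Type u) {L : Type u} [Field K] [Field L] [Algebra K L]
    {c : L} (hc : c ≠ 0) {d : ℕ} (hd : d ≠ 0) : RatFunc K →+* RatFunc L where
  toFun := RatFunc.eval ((algebraMap L (RatFunc L)).comp (algebraMap K L))
    (algebraMap L (RatFunc L) c * RatFunc.X ^ d)
  map_one' := RatFunc.eval_one _ _
  map_zero' := RatFunc.eval_zero _ _
  map_mul' _ _ := RatFunc.eval_mul _ _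
    (eval₂_monomial_ne_zero K hc hd (RatFunc.denom_ne_zero _))
    (eval₂_monomial_ne_zero K hc hd (RatFunc.denom_ne_zero _))
  map_add' _ _ := RatFunc.eval_add _ _
    (eval₂_monomial_ne_zero K hc hd (RatFunc.denom_ne_zero _))
    (eval₂_monomial_ne_zero K hc hd (RatFunc.denom_ne_zero _))

theorem evalMonomialHom_apply (K : Type u) {L : Type u} [Field K] [Field L] [Algebra K L]
    {c : L} (hc : c ≠ 0) {d : ℕ} (hd : d ≠ 0) (φ : RatFunc K) :
    evalMonomialHom K hc hd φ = RatFunc.eval ((algebraMap L (RatFunc L)).comp (algebraMap K L))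
      (algebraMap L (RatFunc L) c * RatFunc.X ^ d) φ :=
  rfl

theorem evalMonomialHom_X (K : Type u) {L : Type u} [Field K] [Field L] [Algebra K L]
    {c : L} (hc : c ≠ 0) {d : ℕ} (hd : d ≠ 0) :
    evalMonomialHom K hc hd RatFunc.X = algebraMap L (RatFunc L) c * RatFunc.X ^ d :=
  RatFunc.eval_X _ _

theorem isLanden_iff_s3 (K : Type u) {L : Type u} [Field K] [Field L] [Algebra K L]
    {m : ℕ} (hm : m ≠ 0) (k : ℤ) (ζ : L) (φ ψ : RatFunc K) :
    IsLanden K L m k ζ φ ψ ↔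
      evalMonomialHom K (one_ne_zero : (1 : L) ≠ 0) hm ψ = landenRHS K L m k ζ φ := by
  simp [IsLanden, evalMonomialHom_apply]

theorem landenRHS_X_zpow (K : Type u) {L : Type u} [Field K] [Field L] [Algebra K L]
    (m : ℕ) (k j : ℤ) {ζ : L} (hζ : ζ ≠ 0) :
    landenRHS K L m k ζ (RatFunc.X ^ j) =
      RatFunc.C ((m : L)⁻¹ * ∑ t ∈ Finset.range m, (ζ ^ (j - k)) ^ t) * RatFunc.X ^ (j - k) := by
  have hX : (RatFunc.X : RatFunc L) ≠ 0 := RatFunc.X_ne_zero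
  have hterm (t : ℕ) : RatFunc.eval ((algebraMap L (RatFunc L)).comp (algebraMap K L))
      (algebraMap L (RatFunc L) (ζ ^ t) * RatFunc.X) (RatFunc.X ^ j) =
      (algebraMap L (RatFunc L) (ζ ^ t) * RatFunc.X) ^ j := by
    have h := map_zpow₀ (evalMonomialHom K (pow_ne_zero t hζ) one_ne_zero) RatFunc.X j
    rwa [evalMonomialHom_X, evalMonomialHom_apply, pow_one] at h
  have hcoef (t : ℕ) : ζ ^ (-(k * (t : ℤ))) * (ζ ^ t) ^ j = (ζ ^ (j - k)) ^ t := by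
    rw [← zpow_natCast, ← zpow_natCast, ← zpow_mul, ← zpow_mul, ← zpow_add₀ hζ]
    congr 1
    ring
  simp only [landenRHS, hterm, mul_zpow, ← mul_assoc, ← map_zpow₀, ← map_mul, hcoef]
  rw [← Finset.sum_mul, ← map_sum, zpow_sub₀ hX, RatFunc.algebraMap_eq_C, map_mul, map_inv₀,
    map_natCast, one_div, mul_inv]
  ring

theorem eq_of_C_mul_X_zpow_eq {L : Type u} [Field L] {c : L} {i j : ℤ}
    (h : RatFunc.C c * (RatFunc.X : RatFunc L) ^ i = RatFunc.X ^ j) : i = j := by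
  have hX : (RatFunc.X : RatFunc L) ≠ 0 := RatFunc.X_ne_zero
  have hc : (RatFunc.C c : RatFunc L) ≠ 0 := by
    intro hc
    rw [hc, zero_mul] at h
    exact zpow_ne_zero j hX h.symm
  have hdeg (i : ℤ) : ((RatFunc.X : RatFunc L) ^ i).intDegree = i := by
    have hpow (a : ℕ) : ((RatFunc.X : RatFunc L) ^ a).intDegree = a := by
      rw [← RatFunc.algebraMap_X, ← map_pow, RatFunc.intDegree_polynomial,
        Polynomial.natDegree_X_pow]
    cases i with
    | ofNat a => simpa using hpow a
    | negSucc a => rw [zpow_negSucc, RatFunc.intDegree_inv, hpow]; rfl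
  have h' := congrArg RatFunc.intDegree h
  rwa [RatFunc.intDegree_mul hc (zpow_ne_zero i hX), RatFunc.intDegree_C, zero_add,
    hdeg, hdeg] at h'

/-- The `(m, k)`-Landen transform sends `z ^ (k + m * a)` to `z ^ a`. -/
theorem IsLanden.eq_X_zpow {K L : Type u} [Field K] [Field L] [Algebra K L]
    {m : ℕ} (hm : m ≠ 0) (hmL : (m : L) ≠ 0) {k a : ℤ} {ζ : L} (hζ : IsPrimitiveRoot ζ m)
    {ψ : RatFunc K} (h : IsLanden K L m k ζ (RatFunc.X ^ (k + m * a)) ψ) :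
    ψ = RatFunc.X ^ a := by
  rw [isLanden_iff_s3 K hm, landenRHS_X_zpow K m k _ (hζ.ne_zero hm)] at h
  apply (evalMonomialHom K (one_ne_zero : (1 : L) ≠ 0) hm).injective
  rw [h, map_zpow₀, evalMonomialHom_X, add_sub_cancel_left, zpow_mul, zpow_natCast, hζ.pow_eq_one,
    zpow_mul, zpow_natCast]
  simp [hmL]

theorem IsLanden.sub_eq_mul {K L : Type u} [Field K] [Field L] [Algebra K L]
    {m : ℕ} (hm : m ≠ 0) {k j a : ℤ} {ζ : L} (hζ : ζ ≠ 0)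
    (h : IsLanden K L m k ζ (RatFunc.X ^ j) (RatFunc.X ^ a)) : j - k = m * a := by
  rw [isLanden_iff_s3 K hm, landenRHS_X_zpow K m k _ hζ, map_zpow₀, evalMonomialHom_X, map_one,
    one_mul, ← zpow_natCast, ← zpow_mul] at h
  exact eq_of_C_mul_X_zpow_eq h.symm

/-- If the Landen transforms `𝔉_{m,k}` and `𝔉_{n,ℓ}` agree on every
rational function `φ ∈ K(z)`, then `m = n` and `k = ℓ`; hence `(m 0; k 1) ↦ 𝔉_{m,k}` is
injective, and it is a monoid isomorphism onto the monoid of Landen transform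
operators. -/
theorem landen_injective (K Lm Ln : Type u) [Field K] [Field Lm] [Field Ln]
    [Algebra K Lm] [Algebra K Ln]
    (m n : ℕ) (hm : 1 ≤ m) (hn : 1 ≤ n) (hmn : ((m * n : ℕ) : K) ≠ 0)
    (k l : ℤ)
    (ζm : Lm) (hζm : IsPrimitiveRoot ζm m)
    (ζn : Ln) (hζn : IsPrimitiveRoot ζn n)
    (Fm Fn : RatFunc K → RatFunc K)
    (hFm : ∀ φ : RatFunc K, IsLanden K Lm m k ζm φ (Fm φ))
    (hFn : ∀ φ : RatFunc K, IsLanden K Ln n l ζn φ (Fn φ))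
    (h : ∀ φ : RatFunc K, Fm φ = Fn φ) :
    m = n ∧ k = l := by
  have hm0 : m ≠ 0 := by omega
  have hn0 : n ≠ 0 := by omega
  have hmL : (m : Lm) ≠ 0 := by
    rw [← map_natCast (algebraMap K Lm)]
    refine (map_ne_zero _).2 fun h0 => hmn ?_
    rw [Nat.cast_mul, h0, zero_mul]
  have key (a : ℤ) : k + m * a - l = n * a := by
    have hψ := (hFm (RatFunc.X ^ (k + m * a))).eq_X_zpow hm0 hmL hζm
    have hL := hFn (RatFunc.X ^ (k + m * a))
    rw [← h, hψ] at hL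
    exact hL.sub_eq_mul hn0 (hζn.ne_zero hn0)
  have h0 := key 0
  have h1 := key 1
  constructor <;> omega
end
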